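/- Let Φ ⊆ ℝ³ be a convex body with twice continuously differentiable boundary which is a rotor in a tetrahedron T, and let x₁, x₂, x₃, x₄ be the points at which the boundary of Φ touches the four faces of T. Let Lᵢ be the normal line to T at xᵢ, i.e. the line through xᵢ perpendicular to the plane of the face containing xᵢ. Then the four normal lines L₁, L₂, L₃, L₄ belong generically to one ruling of a quadric surface. -/

import Mathlib

open Real Set
open scoped InnerProductSpace

noncomputable section

/-- Euclidean 3-space. -/
abbrev V3 : Type := EuclideanSpace ℝ (Fin 3)

/-- The line through `p` with direction `d`. -/
def lineTh (p d : V3) : Set V3 := {q | ∃ t : ℝ, q = p + t • d}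

/-- Four lines (given by points `p i` and directions `d i`) are directionally
independent: no two of them are parallel. -/
def DirIndep (d : Fin 4 → V3) : Prop :=
  ∀ i j : Fin 4, i ≠ j → LinearIndependent ℝ ![d i, d j]

/-- Four directionally independent lines belong generically to one ruling of a quadric
surface: they are concurrent; or they are pairwise disjoint and lie on a quadric
surface (the zero set of a nonzero polynomial of degree at most 2); or they meet in
pairs and the two planes these pairs generate meet in the line through the two
intersection points. -/
def GenOneRuling (p d : Fin 4 → V3) : Prop :=
  (∃ q : V3, ∀ i, q ∈ lineTh (p i) (d i)) ∨
  ((∀ i j : Fin 4, i ≠ j → lineTh (p i) (d i) ∩ lineTh (p j) (d j) = ∅) ∧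
    ∃ Q : MvPolynomial (Fin 3) ℝ, Q ≠ 0 ∧ Q.totalDegree ≤ 2 ∧
      ∀ i, ∀ y ∈ lineTh (p i) (d i), MvPolynomial.eval (fun j => y j) Q = 0) ∨
  (∃ σ : Equiv.Perm (Fin 4), ∃ q₁ q₂ : V3, q₁ ≠ q₂ ∧
    q₁ ∈ lineTh (p (σ 0)) (d (σ 0)) ∩ lineTh (p (σ 1)) (d (σ 1)) ∧
    q₂ ∈ lineTh (p (σ 2)) (d (σ 2)) ∩ lineTh (p (σ 3)) (d (σ 3)) ∧
    affineSpan ℝ (lineTh (p (σ 0)) (d (σ 0)) ∪ lineTh (p (σ 1)) (d (σ 1))) ⊓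
      affineSpan ℝ (lineTh (p (σ 2)) (d (σ 2)) ∪ lineTh (p (σ 3)) (d (σ 3))) =
      affineSpan ℝ ({q₁, q₂} : Set V3))

/-- The tetrahedron with vertices `B 0, …, B 3` is circumscribed about a convex body
`φ`: `φ` is contained in the tetrahedron and each face lies on a support plane of
`φ`; since `φ` is inside the tetrahedron, the latter amounts to the plane of each face
meeting `φ`. -/
def TetraCircumscribed (B : Fin 4 → V3) (φ : Set V3) : Prop :=
  φ ⊆ convexHull ℝ (Set.range B) ∧
  ∀ i : Fin 4, ∃ y ∈ φ, y ∈ affineSpan ℝ (B '' {i}ᶜ)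

/-- `φ` is a rotor in the tetrahedron with vertices `B` if for every rotation `ρ`
(orientation-preserving linear isometry) there is a translation `τ` such that the
tetrahedron is circumscribed about `τ(ρ(φ))`. -/
def IsRotorInTetra (B : Fin 4 → V3) (φ : Set V3) : Prop :=
  ∀ ρ : V3 ≃ₗᵢ[ℝ] V3, 0 < LinearMap.det (ρ.toLinearEquiv : V3 →ₗ[ℝ] V3) →
    ∃ τ : V3, TetraCircumscribed B ((fun y => ρ y + τ) '' φ)

/-- The determinant of three vectors of Euclidean 3-space. -/
def tripleProd (u v w : V3) : ℝ :=
  u 0 * (v 1 * w 2 - v 2 * w 1) - u 1 * (v 0 * w 2 - v 2 * w 0)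
    + u 2 * (v 0 * w 1 - v 1 * w 0)

/-- The moments of the vectors `N i` applied at the points `x i` sum to zero. -/
def MomentsBalanced (x N : Fin 4 → V3) : Prop :=
  ∑ i, (x i 1 * N i 2 - x i 2 * N i 1) = 0 ∧
  ∑ i, (x i 2 * N i 0 - x i 0 * N i 2) = 0 ∧
  ∑ i, (x i 0 * N i 1 - x i 1 * N i 0) = 0

/-- Every linear relation between the vectors `N i` has constant coefficients. -/
def OnlyConstRel (N : Fin 4 → V3) : Prop :=
  ∀ c : Fin 4 → ℝ, ∑ i, c i • N i = 0 → ∀ i j, c i = c j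

theorem OnlyConstRel.tripleProd_ne_zero {N : Fin 4 → V3} (h : OnlyConstRel N) :
    tripleProd (N 0) (N 1) (N 2) ≠ 0 := by
  intro hdet
  have hM : (Matrix.of ![(N 0).ofLp, (N 1).ofLp, (N 2).ofLp]).det = 0 := by
    rw [Matrix.det_fin_three]
    simp only [Matrix.of_apply, Matrix.cons_val]
    unfold tripleProd at hdet
    linarith
  obtain ⟨v, hv, hvM⟩ := Matrix.exists_vecMul_eq_zero_iff.2 hM
  have key := h ![v 0, v 1, v 2, 0] (by
    ext k
    have := congrFun hvM k
    simp [Matrix.vecMul, dotProduct, Fin.sum_univ_three] at this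
    simp [Fin.sum_univ_four]
    linarith)
  have h0 := key 0 3
  have h1 := key 1 3
  have h2 := key 2 3
  simp at h0 h1 h2
  exact hv (by ext k; fin_cases k <;> simp [h0, h1, h2])

theorem exists_combination {a b c : V3} (h : tripleProd a b c ≠ 0) (u : V3) :
    u = (tripleProd u b c / tripleProd a b c) • a + (tripleProd a u c / tripleProd a b c) • b
      + (tripleProd a b u / tripleProd a b c) • c := by
  ext k
  simp only [PiLp.add_apply, PiLp.smul_apply, smul_eq_mul]
  field_simp
  unfold tripleProd
  fin_cases k <;> simp <;> ring

/-- Two coplanar nonparallel lines meet. -/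
theorem lines_meet {p q a b c : V3} (h : tripleProd a b c ≠ 0)
    (h0 : tripleProd a b (p - q) = 0) : (lineTh p a ∩ lineTh q b).Nonempty := by
  have e := exists_combination h (p - q)
  rw [h0] at e
  set s := tripleProd (p - q) b c / tripleProd a b c
  set t := tripleProd a (p - q) c / tripleProd a b c
  refine ⟨p + (-s) • a, ⟨-s, rfl⟩, t, ?_⟩
  have : p = q + (p - q) := by abel
  rw [this, e]
  module

theorem affineSpan_two_lines {q p p' a b : V3} (h : q ∈ lineTh p a) (h' : q ∈ lineTh p' b)
    (z : V3) :
    z ∈ affineSpan ℝ (lineTh p a ∪ lineTh p' b) ↔ ∃ s t : ℝ, z = q + s • a + t • b := by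
  obtain ⟨s₀, hs₀⟩ := h
  obtain ⟨t₀, ht₀⟩ := h'
  have hp : p = q - s₀ • a := by rw [hs₀]; module
  have hp' : p' = q - t₀ • b := by rw [ht₀]; module
  constructor
  · intro hz
    have hle : affineSpan ℝ (lineTh p a ∪ lineTh p' b) ≤
        AffineSubspace.mk' q (Submodule.span ℝ {a, b}) := by
      refine affineSpan_le.2 ?_
      rintro y (⟨r, rfl⟩ | ⟨r, rfl⟩)
      · refine (AffineSubspace.mem_mk').2 (Submodule.mem_span_pair.2 ⟨r - s₀, 0, ?_⟩)
        rw [hp, vsub_eq_sub]; module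
      · refine (AffineSubspace.mem_mk').2 (Submodule.mem_span_pair.2 ⟨0, r - t₀, ?_⟩)
        rw [hp', vsub_eq_sub]; module
    obtain ⟨s, t, hst⟩ := Submodule.mem_span_pair.1 ((AffineSubspace.mem_mk').1 (hle hz))
    refine ⟨s, t, ?_⟩
    rw [add_assoc, hst, vsub_eq_sub]; abel
  · rintro ⟨s, t, rfl⟩
    have hq : q ∈ affineSpan ℝ (lineTh p a ∪ lineTh p' b) :=
      subset_affineSpan ℝ _ (Or.inl ⟨s₀, hs₀⟩)
    have ha : q + s • a ∈ affineSpan ℝ (lineTh p a ∪ lineTh p' b) :=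
      subset_affineSpan ℝ _ (Or.inl ⟨s₀ + s, by rw [hp]; module⟩)
    have hb : q + t • b ∈ affineSpan ℝ (lineTh p a ∪ lineTh p' b) :=
      subset_affineSpan ℝ _ (Or.inr ⟨t₀ + t, by rw [hp']; module⟩)
    have := AffineSubspace.smul_vsub_vadd_mem _ (1 : ℝ) ha hq hb
    convert this using 1
    simp only [vsub_eq_sub, vadd_eq_add]; module

/-- If four balanced forces act along four lines, two of which meet, then the lines are
concurrent or the other two also meet and the planes of the pairs intersect in the line through
the two intersection points. -/
theorem balanced_meeting {x N : Fin 4 → V3} (hsum : ∑ i, N i = 0) (hrel : OnlyConstRel N)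
    (hmom : MomentsBalanced x N) {q₁ : V3} (h₀ : q₁ ∈ lineTh (x 0) (N 0))
    (h₁ : q₁ ∈ lineTh (x 1) (N 1)) :
    (∃ q : V3, ∀ i, q ∈ lineTh (x i) (N i)) ∨
    ∃ q₁ q₂ : V3, q₁ ≠ q₂ ∧ q₁ ∈ lineTh (x 0) (N 0) ∩ lineTh (x 1) (N 1) ∧
      q₂ ∈ lineTh (x 2) (N 2) ∩ lineTh (x 3) (N 3) ∧
      affineSpan ℝ (lineTh (x 0) (N 0) ∪ lineTh (x 1) (N 1)) ⊓
        affineSpan ℝ (lineTh (x 2) (N 2) ∪ lineTh (x 3) (N 3)) =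
        affineSpan ℝ ({q₁, q₂} : Set V3) := by
  have hdet := hrel.tripleProd_ne_zero
  obtain ⟨t₀, ht₀⟩ := id h₀
  obtain ⟨t₁, ht₁⟩ := id h₁
  have hx0 : x 0 = q₁ - t₀ • N 0 := by rw [ht₀]; module
  have hx1 : x 1 = q₁ - t₁ • N 1 := by rw [ht₁]; module
  have hN3 : N 3 = -N 0 - N 1 - N 2 := by
    rw [Fin.sum_univ_four] at hsum
    rw [← sub_eq_zero, ← hsum]; abel
  obtain ⟨m0, m1, m2⟩ := hmom
  simp only [Fin.sum_univ_four, hx0, hx1, hN3, PiLp.sub_apply, PiLp.smul_apply, PiLp.neg_apply,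
    smul_eq_mul] at m0 m1 m2
  have hdet' : tripleProd (N 2) (N 3) (N 0) ≠ 0 := by
    have : tripleProd (N 2) (N 3) (N 0) = tripleProd (N 0) (N 1) (N 2) := by
      rw [hN3]; simp [tripleProd]; ring
    rwa [this]
  obtain ⟨q₂, h₂, h₃⟩ : (lineTh (x 2) (N 2) ∩ lineTh (x 3) (N 3)).Nonempty := by
    refine lines_meet hdet' ?_
    rw [hN3]
    simp only [tripleProd, PiLp.sub_apply, PiLp.neg_apply]
    linear_combination -(N 0 0 + N 1 0) * m0 - (N 0 1 + N 1 1) * m1 - (N 0 2 + N 1 2) * m2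
  by_cases hq : q₁ = q₂
  · left
    refine ⟨q₁, fun i => ?_⟩
    fin_cases i
    exacts [h₀, h₁, hq ▸ h₂, hq ▸ h₃]
  right
  refine ⟨q₁, q₂, hq, ⟨h₀, h₁⟩, ⟨h₂, h₃⟩, ?_⟩
  obtain ⟨t₂, ht₂⟩ := id h₂
  obtain ⟨t₃, ht₃⟩ := id h₃
  have hx2 : x 2 = q₂ - t₂ • N 2 := by rw [ht₂]; module
  have hx3 : x 3 = q₂ - t₃ • N 3 := by rw [ht₃]; module
  simp only [hx2, hx3, hN3, PiLp.sub_apply, PiLp.smul_apply, PiLp.neg_apply,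
    smul_eq_mul] at m0 m1 m2
  obtain ⟨r, hr⟩ : ∃ r : ℝ, q₂ - q₁ = r • (N 0 + N 1) := by
    have e := exists_combination hdet (q₂ - q₁)
    have hc : tripleProd (N 0) (N 1) (q₂ - q₁) = 0 := by
      simp only [tripleProd, PiLp.sub_apply]
      linear_combination N 0 0 * m0 + N 0 1 * m1 + N 0 2 * m2
    have hab : tripleProd (q₂ - q₁) (N 1) (N 2) = tripleProd (N 0) (q₂ - q₁) (N 2) := by
      simp only [tripleProd, PiLp.sub_apply]
      linear_combination -N 2 0 * m0 - N 2 1 * m1 - N 2 2 * m2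
    rw [hc, hab] at e
    refine ⟨tripleProd (N 0) (q₂ - q₁) (N 2) / tripleProd (N 0) (N 1) (N 2), e.trans ?_⟩
    rw [zero_div, zero_smul, add_zero, smul_add]
  have hr0 : r ≠ 0 := by
    rintro rfl
    rw [zero_smul, sub_eq_zero] at hr
    exact hq hr.symm
  have hq₂ : q₂ = q₁ + r • (N 0 + N 1) := by rw [← hr]; abel
  ext z
  rw [AffineSubspace.mem_inf_iff, affineSpan_two_lines h₀ h₁, affineSpan_two_lines h₂ h₃,
    mem_affineSpan_pair_iff_exists_lineMap_eq]
  constructor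
  · rintro ⟨⟨a, b, hz⟩, c, e, hz'⟩
    have key := hrel ![a - r + e, b - r + e, e - c, 0] (by
      have h0 : q₁ + a • N 0 + b • N 1 - (q₂ + c • N 2 + e • N 3) = 0 := by
        rw [← hz, ← hz', sub_self]
      rw [← h0, hq₂, hN3]
      simp [Fin.sum_univ_four]
      module)
    have e0 := key 0 3
    have e1 := key 1 3
    simp at e0 e1
    refine ⟨a / r, ?_⟩
    have hb : b = a := by linarith
    rw [AffineMap.lineMap_apply, vsub_eq_sub, vadd_eq_add, hr, smul_smul, div_mul_cancel₀ _ hr0,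
      hz, hb]
    module
  · rintro ⟨s, rfl⟩
    rw [AffineMap.lineMap_apply, vsub_eq_sub, vadd_eq_add, hr]
    refine ⟨⟨s * r, s * r, by module⟩, (1 - s) * r, (1 - s) * r, ?_⟩
    rw [hq₂, hN3]
    module

/-- A quadratic function given by products of linear forms is a polynomial of degree at most
two. -/
theorem exists_quadratic_polynomial (A : Fin 3 → Fin 3 → ℝ) (b : Fin 3 → ℝ) (c : ℝ) :
    ∃ Q : MvPolynomial (Fin 3) ℝ, Q.totalDegree ≤ 2 ∧ ∀ y : Fin 3 → ℝ,
      MvPolynomial.eval y Q = ∑ i, ∑ j, A i j * y i * y j + ∑ i, b i * y i + c := by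
  refine ⟨∑ i, ∑ j, MvPolynomial.C (A i j) * MvPolynomial.X i * MvPolynomial.X j
    + ∑ i, MvPolynomial.C (b i) * MvPolynomial.X i + MvPolynomial.C c, ?_, fun y => by simp⟩
  have hb : ∀ (r : ℝ) (i : Fin 3),
      (MvPolynomial.C r * MvPolynomial.X i : MvPolynomial (Fin 3) ℝ).totalDegree ≤ 1 := by
    intro r i
    refine (MvPolynomial.totalDegree_mul _ _).trans ?_
    simp
  refine (MvPolynomial.totalDegree_add _ _).trans (max_le ?_ (by simp))
  refine (MvPolynomial.totalDegree_add _ _).trans (max_le ?_ ?_)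
  · refine MvPolynomial.totalDegree_finsetSum_le fun i _ =>
      MvPolynomial.totalDegree_finsetSum_le fun j _ => ?_
    refine (MvPolynomial.totalDegree_mul _ _).trans ?_
    have := hb (A i j) i
    simp only [MvPolynomial.totalDegree_X]
    omega
  · exact MvPolynomial.totalDegree_finsetSum_le fun i _ => (hb _ i).trans one_le_two

/-- The cross product of vectors of Euclidean 3-space. -/
def crossV (u v : V3) : V3 :=
  !₂[u 1 * v 2 - u 2 * v 1, u 2 * v 0 - u 0 * v 2, u 0 * v 1 - u 1 * v 0]

@[simp] theorem crossV_zero (u v : V3) : crossV u v 0 = u 1 * v 2 - u 2 * v 1 := rfl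
@[simp] theorem crossV_one (u v : V3) : crossV u v 1 = u 2 * v 0 - u 0 * v 2 := rfl
@[simp] theorem crossV_two (u v : V3) : crossV u v 2 = u 0 * v 1 - u 1 * v 0 := rfl

/-- The regulus of three lines, as a quadratic polynomial: it vanishes at `y` when the planes
joining `y` to the three lines have dependent normals. -/
theorem exists_regulus_polynomial (p a : Fin 3 → V3) :
    ∃ Q : MvPolynomial (Fin 3) ℝ, Q.totalDegree ≤ 2 ∧ ∀ y : V3,
      MvPolynomial.eval (fun j => y j) Q = tripleProd (crossV (y - p 0) (a 0))
        (crossV (y - p 1) (a 1)) (crossV (y - p 2) (a 2)) := by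
  set M : Fin 3 → V3 := fun i => crossV (p i) (a i) with hM
  obtain ⟨Q, hQ, hev⟩ := exists_quadratic_polynomial
    (fun i j => -(M 0 i * crossV (a 1) (a 2) j + M 1 i * crossV (a 2) (a 0) j
      + M 2 i * crossV (a 0) (a 1) j))
    (fun i => crossV (a 2) (crossV (M 0) (M 1)) i + crossV (a 0) (crossV (M 1) (M 2)) i
      + crossV (a 1) (crossV (M 2) (M 0)) i)
    (-tripleProd (M 0) (M 1) (M 2))
  refine ⟨Q, hQ, fun y => ?_⟩
  have hM' : ∀ i, crossV (y - p i) (a i) = crossV y (a i) - M i := by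
    intro i; ext k; fin_cases k <;> simp [hM] <;> ring
  rw [hev, hM', hM', hM']
  generalize M 0 = m0
  generalize M 1 = m1
  generalize M 2 = m2
  simp only [tripleProd, Fin.sum_univ_three, crossV_zero, crossV_one, crossV_two,
    PiLp.sub_apply]
  ring

theorem balanced_skew {x N : Fin 4 → V3} (hsum : ∑ i, N i = 0) (hrel : OnlyConstRel N)
    (hmom : MomentsBalanced x N) (hskew : lineTh (x 0) (N 0) ∩ lineTh (x 1) (N 1) = ∅) :
    ∃ Q : MvPolynomial (Fin 3) ℝ, Q ≠ 0 ∧ Q.totalDegree ≤ 2 ∧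
      ∀ i, ∀ y ∈ lineTh (x i) (N i), MvPolynomial.eval (fun j => y j) Q = 0 := by
  have hdet := hrel.tripleProd_ne_zero
  obtain ⟨Q, hQ, hev⟩ := exists_regulus_polynomial ![x 0, x 1, x 2] ![N 0, N 1, N 2]
  simp only [Matrix.cons_val] at hev
  refine ⟨Q, ?_, hQ, ?_⟩
  · rintro rfl
    have h : tripleProd (N 0) (N 1) (x 0 - x 1) ≠ 0 := fun h0 =>
      (lines_meet hdet h0).ne_empty hskew
    have e1 := hev (x 0 + N 0 + N 1)
    have e2 := hev (x 0 + N 1)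
    have : tripleProd (N 0) (N 1) (N 2) * tripleProd (N 0) (N 1) (x 0 - x 1) = 0 := by
      simp only [map_zero, tripleProd, crossV_zero, crossV_one, crossV_two, PiLp.add_apply,
        PiLp.sub_apply] at e1 e2 ⊢
      linear_combination e1 - e2
    exact (mul_ne_zero hdet h) this
  · rintro i y ⟨t, rfl⟩
    rw [hev]
    fin_cases i
    · simp [tripleProd]; ring
    · simp [tripleProd]; ring
    · simp [tripleProd]; ring
    · have hN3 : N 3 = -N 0 - N 1 - N 2 := by
        rw [Fin.sum_univ_four] at hsum
        rw [← sub_eq_zero, ← hsum]; abel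
      have hz : crossV (x 3 + t • N 3 - x 2) (N 2) = -crossV (x 3 + t • N 3 - x 0) (N 0)
          - crossV (x 3 + t • N 3 - x 1) (N 1) := by
        obtain ⟨m0, m1, m2⟩ := hmom
        simp only [Fin.sum_univ_four, hN3, PiLp.sub_apply, PiLp.neg_apply] at m0 m1 m2
        ext k
        fin_cases k
        · simp [hN3]; linear_combination -m0
        · simp [hN3]; linear_combination -m1
        · simp [hN3]; linear_combination -m2
      simp only [Fin.reduceFinMk]
      rw [hz]
      generalize crossV (x 3 + t • N 3 - x 0) (N 0) = u
      generalize crossV (x 3 + t • N 3 - x 1) (N 1) = v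
      simp only [tripleProd, PiLp.sub_apply, PiLp.neg_apply]
      ring

theorem OnlyConstRel.comp_perm {N : Fin 4 → V3} (h : OnlyConstRel N)
    (σ : Equiv.Perm (Fin 4)) : OnlyConstRel (N ∘ σ) := by
  intro c hc i j
  have := h (c ∘ σ.symm) (by
    rw [← hc, ← Equiv.sum_comp σ]; simp) (σ i) (σ j)
  simpa using this

theorem MomentsBalanced.comp_perm {x N : Fin 4 → V3} (h : MomentsBalanced x N)
    (σ : Equiv.Perm (Fin 4)) : MomentsBalanced (x ∘ σ) (N ∘ σ) := by
  obtain ⟨h0, h1, h2⟩ := h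
  refine ⟨?_, ?_, ?_⟩
  · exact (Equiv.sum_comp σ _).trans h0
  · exact (Equiv.sum_comp σ _).trans h1
  · exact (Equiv.sum_comp σ _).trans h2

/-- The lines of action of four balanced forces, no three of which are linearly dependent,
belong generically to one ruling of a quadric surface. -/
theorem genOneRuling_of_balanced {x N : Fin 4 → V3} (hsum : ∑ i, N i = 0)
    (hrel : OnlyConstRel N) (hmom : MomentsBalanced x N) : GenOneRuling x N := by
  by_cases hdisj : ∀ i j : Fin 4, i ≠ j → lineTh (x i) (N i) ∩ lineTh (x j) (N j) = ∅
  · exact Or.inr (Or.inl ⟨hdisj, balanced_skew hsum hrel hmom (hdisj 0 1 (by decide))⟩)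
  push Not at hdisj
  obtain ⟨i, j, hij, q, hqi, hqj⟩ := hdisj
  obtain ⟨σ, hσi, hσj⟩ : ∃ σ : Equiv.Perm (Fin 4), σ 0 = i ∧ σ 1 = j := by
    clear hqi hqj
    revert i j; decide
  subst hσi hσj
  have hsum' : ∑ i, (N ∘ σ) i = 0 := (Equiv.sum_comp σ N).trans hsum
  rcases balanced_meeting hsum' (hrel.comp_perm σ) (hmom.comp_perm σ) hqi hqj with
    ⟨q, hq⟩ | ⟨q₁, q₂, h⟩
  · exact Or.inl ⟨q, fun i => by simpa using hq (σ.symm i)⟩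
  · exact Or.inr (Or.inr ⟨σ, q₁, q₂, h⟩)

/-- An orthogonal matrix of positive determinant acts as a rotation. -/
theorem exists_rotation_of_matrix (A : Matrix (Fin 3) (Fin 3) ℝ) (hA : A.transpose * A = 1)
    (hdet : 0 < A.det) : ∃ ρ : V3 ≃ₗᵢ[ℝ] V3,
      0 < LinearMap.det (ρ.toLinearEquiv : V3 →ₗ[ℝ] V3) ∧
      ∀ y i, ρ y i = ∑ j, A i j * y j := by
  have hnorm : ∀ y : V3, ‖Matrix.toEuclideanLin A y‖ = ‖y‖ := by
    intro y
    rw [← sq_eq_sq₀ (norm_nonneg _) (norm_nonneg _), ← real_inner_self_eq_norm_sq,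
      ← real_inner_self_eq_norm_sq, EuclideanSpace.inner_eq_star_dotProduct,
      EuclideanSpace.inner_eq_star_dotProduct]
    simp [Matrix.toLpLin_apply, Matrix.dotProduct_mulVec, Matrix.vecMul_mulVec, hA]
  let f : V3 →ₗᵢ[ℝ] V3 := ⟨Matrix.toEuclideanLin A, hnorm⟩
  refine ⟨f.toLinearIsometryEquiv rfl, ?_, fun y i => rfl⟩
  have : ((f.toLinearIsometryEquiv rfl).toLinearEquiv : V3 →ₗ[ℝ] V3) = Matrix.toEuclideanLin A := by
    ext; rfl
  rw [this]
  exact hdet.trans_eq (LinearMap.det_toLin (PiLp.basisFun 2 ℝ (Fin 3)) A).symm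

theorem eq_zero_of_trig_min {a b c : ℝ} (h : ∀ t, a + c ≤ a * cos t + b * sin t + c) : b = 0 := by
  have hd : HasDerivAt (fun t => a * cos t + b * sin t + c) (a * -sin 0 + b * cos 0) 0 :=
    (((hasDerivAt_cos 0).const_mul a).add ((hasDerivAt_sin 0).const_mul b)).add_const c
  have hmin : IsLocalMin (fun t => a * cos t + b * sin t + c) 0 :=
    Filter.Eventually.of_forall fun t => by simpa using h t
  simpa using hmin.hasDerivAt_eq_zero hd

/-- If the identity minimises `∑ i, ⟪N i, ρ (x i)⟫` over all rotations `ρ`, then the moments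
balance. -/
theorem momentsBalanced_of_min {x N : Fin 4 → V3}
    (h : ∀ ρ : V3 ≃ₗᵢ[ℝ] V3, 0 < LinearMap.det (ρ.toLinearEquiv : V3 →ₗ[ℝ] V3) →
      ∑ i, ⟪N i, x i⟫_ℝ ≤ ∑ i, ⟪N i, ρ (x i)⟫_ℝ) : MomentsBalanced x N := by
  have hin : ∀ u v : V3, ⟪u, v⟫_ℝ = u 0 * v 0 + u 1 * v 1 + u 2 * v 2 := by
    intro u v
    simp [PiLp.inner_apply, Fin.sum_univ_three, mul_comm]
  have hcs := fun t => sin_sq_add_cos_sq t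
  refine ⟨?_, ?_, ?_⟩
  · refine eq_zero_of_trig_min (a := ∑ i, (N i 1 * x i 1 + N i 2 * x i 2))
      (c := ∑ i, N i 0 * x i 0) fun t => ?_
    obtain ⟨ρ, hρ, hρy⟩ := exists_rotation_of_matrix
      !![1, 0, 0; 0, cos t, -sin t; 0, sin t, cos t]
      (by ext i j; fin_cases i <;> fin_cases j <;>
            simp [Matrix.mul_apply, Fin.sum_univ_three] <;> linarith [hcs t])
      (by rw [Matrix.det_fin_three]; simp; nlinarith [hcs t])
    have := h ρ hρ
    simp [hin, hρy, Fin.sum_univ_three, Fin.sum_univ_four] at this ⊢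
    linarith
  · refine eq_zero_of_trig_min (a := ∑ i, (N i 0 * x i 0 + N i 2 * x i 2))
      (c := ∑ i, N i 1 * x i 1) fun t => ?_
    obtain ⟨ρ, hρ, hρy⟩ := exists_rotation_of_matrix
      !![cos t, 0, sin t; 0, 1, 0; -sin t, 0, cos t]
      (by ext i j; fin_cases i <;> fin_cases j <;>
            simp [Matrix.mul_apply, Fin.sum_univ_three] <;> linarith [hcs t])
      (by rw [Matrix.det_fin_three]; simp; nlinarith [hcs t])
    have := h ρ hρ
    simp [hin, hρy, Fin.sum_univ_three, Fin.sum_univ_four] at this ⊢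
    linarith
  · refine eq_zero_of_trig_min (a := ∑ i, (N i 0 * x i 0 + N i 1 * x i 1))
      (c := ∑ i, N i 2 * x i 2) fun t => ?_
    obtain ⟨ρ, hρ, hρy⟩ := exists_rotation_of_matrix
      !![cos t, -sin t, 0; sin t, cos t, 0; 0, 0, 1]
      (by ext i j; fin_cases i <;> fin_cases j <;>
            simp [Matrix.mul_apply, Fin.sum_univ_three] <;> linarith [hcs t])
      (by rw [Matrix.det_fin_three]; simp; nlinarith [hcs t])
    have := h ρ hρ
    simp [hin, hρy, Fin.sum_univ_three, Fin.sum_univ_four] at this ⊢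
    linarith

theorem lineTh_smul (p v : V3) {c : ℝ} (hc : c ≠ 0) : lineTh p (c • v) = lineTh p v := by
  ext q
  constructor
  · rintro ⟨t, rfl⟩
    exact ⟨t * c, by rw [smul_smul]⟩
  · rintro ⟨t, rfl⟩
    exact ⟨t / c, by rw [smul_smul, div_mul_cancel₀ _ hc]⟩

theorem AffineBasis.coord_eq_zero_of_mem_face (b : AffineBasis (Fin 4) ℝ V3) {i : Fin 4} {y : V3}
    (hy : y ∈ affineSpan ℝ (b '' {i}ᶜ)) : b.coord i y = 0 := by
  have h := AffineSubspace.mem_map_of_mem (b.coord i) hy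
  rw [AffineSubspace.map_span] at h
  have hsub : b.coord i '' (b '' {i}ᶜ) ⊆ {0} := by
    rintro _ ⟨_, ⟨j, hj, rfl⟩, rfl⟩
    exact b.coord_apply_ne (Ne.symm hj)
  have := affineSpan_mono ℝ hsub h
  rwa [AffineSubspace.mem_affineSpan_singleton] at this

/-- **Theorem 4 (rotors in a tetrahedron).**  If `Φ` is a convex body with `C²`
boundary which is a rotor in the tetrahedron with vertices `B`, touching the four
faces at the points `x i`, then the normal lines to the faces at the `x i` belong
generically to one ruling of a quadric surface. -/
theorem rotor_in_tetrahedron_normals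
    (B : Fin 4 → V3) (hB : AffineIndependent ℝ B)
    (Φ : Set V3)
    (hconv : Convex ℝ Φ) (hcomp : IsCompact Φ) (hint : (interior Φ).Nonempty)
    -- the boundary of `Φ` is a twice continuously differentiable surface:
    -- `Φ` is the sublevel set of a `C²` function with nonvanishing gradient on `bd Φ`
    (F : V3 → ℝ) (hF : ContDiff ℝ 2 F)
    (hΦF : Φ = {y : V3 | F y ≤ 0})
    (hbdF : frontier Φ = {y : V3 | F y = 0})
    (hgrad : ∀ y ∈ frontier Φ, gradient F y ≠ 0)
    -- `Φ` is a rotor in the tetrahedron, which is circumscribed about it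
    (hcirc : TetraCircumscribed B Φ)
    (hrotor : IsRotorInTetra B Φ)
    -- `Φ` touches the plane of the `i`-th face exactly at the point `x i`
    (x : Fin 4 → V3)
    (hx : ∀ i : Fin 4, Φ ∩ (affineSpan ℝ (B '' {i}ᶜ) : Set V3) = {x i})
    -- `d i` is the direction normal to the `i`-th face
    (d : Fin 4 → V3) (hd : ∀ i, d i ≠ 0)
    (hperp : ∀ i j : Fin 4, j ≠ i → ⟪d i, B j - x i⟫_ℝ = 0)
    (hind : DirIndep d) :
    GenOneRuling x d := by
  have hspan : affineSpan ℝ (Set.range B) = ⊤ := by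
    rw [hB.affineSpan_eq_top_iff_card_eq_finrank_add_one]; simp
  let b : AffineBasis (Fin 4) ℝ V3 := ⟨B, hB, hspan⟩
  have hbB : ∀ j, b j = B j := fun _ => rfl
  let N : Fin 4 → V3 := fun i =>
    (InnerProductSpace.toDual ℝ V3).symm (LinearMap.toContinuousLinearMap (b.coord i).linear)
  have hN : ∀ i y z, ⟪N i, y - z⟫_ℝ = b.coord i y - b.coord i z := by
    intro i y z
    simp only [N, InnerProductSpace.toDual_symm_apply, LinearMap.coe_toContinuousLinearMap']
    rw [← vsub_eq_sub y z, AffineMap.linearMap_vsub, vsub_eq_sub]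
  have hcoordB : ∀ i j, b.coord i (B j) = if i = j then 1 else 0 := fun i j => b.coord_apply i j
  have hx0 : ∀ i, b.coord i (x i) = 0 := fun i =>
    b.coord_eq_zero_of_mem_face ((hx i).ge (Set.mem_singleton _)).2
  have hsum : ∑ i, N i = 0 := by
    refine ext_inner_right ℝ fun v => ?_
    have := fun i => hN i v 0
    simp only [sub_zero] at this
    simp [sum_inner, this]
  have hrel : OnlyConstRel N := by
    intro c hc j k
    have h := congrArg (fun w => ⟪w, B j - B k⟫_ℝ) hc
    simp [sum_inner, inner_smul_left, hN, hcoordB, mul_sub, Finset.sum_sub_distrib] at h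
    linarith
  have hmom : MomentsBalanced x N := by
    refine momentsBalanced_of_min fun ρ hρ => ?_
    obtain ⟨τ, hτ, -⟩ := hrotor ρ hρ
    have hnn : ∀ i, 0 ≤ ⟪N i, ρ (x i) + τ - x i⟫_ℝ := by
      intro i
      have hmem := hτ ⟨x i, ((hx i).ge (Set.mem_singleton _)).1, rfl⟩
      have : Set.range B = Set.range b := rfl
      rw [this, b.convexHull_eq_nonneg_coord] at hmem
      rw [hN, hx0, sub_zero]
      exact hmem i
    have hs := Finset.sum_nonneg fun i (_ : i ∈ Finset.univ) => hnn i
    simp only [inner_sub_right, inner_add_right, Finset.sum_sub_distrib,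
      Finset.sum_add_distrib] at hs
    rw [← sum_inner, hsum, inner_zero_left] at hs
    linarith
  have hdN : ∀ i, d i = ⟪d i, B i - x i⟫_ℝ • N i := by
    intro i
    set c := ⟪d i, B i - x i⟫_ℝ with hc
    have hw : ∀ j, ⟪d i - c • N i, B j - x i⟫_ℝ = 0 := by
      intro j
      rw [inner_sub_left, real_inner_smul_left, hN, hx0, hcoordB]
      by_cases hij : i = j
      · subst hij; simp [hc]
      · simp [hij, hperp i j (Ne.symm hij)]
    have hy : ∀ y, ⟪d i - c • N i, y - x i⟫_ℝ = 0 := by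
      intro y
      have e : y - x i = ∑ j, b.coord j y • (B j - x i) := by
        simp only [smul_sub, Finset.sum_sub_distrib]
        rw [← Finset.sum_smul, b.sum_coord_apply_eq_one, one_smul]
        exact congrArg (· - x i) (b.linear_combination_coord_eq_self y).symm
      rw [e, inner_sum]
      simp [inner_smul_right, hw]
    have h := hy (d i - c • N i + x i)
    rw [add_sub_cancel_right, inner_self_eq_zero, sub_eq_zero] at h
    exact h
  have hline : ∀ i, lineTh (x i) (d i) = lineTh (x i) (N i) := by
    intro i
    rw [hdN i]
    refine lineTh_smul _ _ fun hc => hd i ?_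
    rw [hdN i, hc, zero_smul]
  have := genOneRuling_of_balanced hsum hrel hmom
  unfold GenOneRuling at this ⊢
  simp only [hline]
  exact this
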